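/- arXiv:math/0305410 — 4 statements merged into one kernel-verified Lean document; each statement's English description precedes it below -/
import Mathlib

section
/- Let dₙ (for n ≥ 1) be the number of triples (τ₁, τ₂, τ₃) of permutations of {1, …, n} such that for each j, at least one of τ₁(j), τ₂(j), τ₃(j) equals j, the other two are equal to each other, and not all three equal j; set d₀ = 1, and let d_{n,k} = C(n,k) · d_{n−k}. Then for every n ≥ 1 and every real t, Σ_{k=0}^{n} d_{n,k} t^k = ((n+2)!/2) · φ(t − 3, n), where φ(t, n) = (1 − 2t/(n+2) + t²/((n+1)(n+2))) · Σ_{k=0}^{n} t^k / k! + t^{n+1}/(n+1)! − t^{n+2}/(n+2)!. Equivalently, Σ_{k=0}^{n} d_{n,k} t^k = (n!/2) Σ_{k=0}^{n} ((n+1−k)(n+2−k)/k!) (t−3)^k. -/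
/-- The number `dₙ` of triples `(τ₁, τ₂, τ₃)` of permutations of `{1, …, n}` such that for
each `j`, at least one of `τ₁ j, τ₂ j, τ₃ j` equals `j`, the other two are equal to each
other, and not all three equal `j`.  (For `n = 0` this number is `1`, matching the
convention `d₀ = 1`.) -/
noncomputable def dTriples (n : ℕ) : ℕ :=
  Nat.card {t : Equiv.Perm (Fin n) × Equiv.Perm (Fin n) × Equiv.Perm (Fin n) //
    ∀ j : Fin n,
      ((t.1 j = j ∧ t.2.1 j = t.2.2 j) ∨ (t.2.1 j = j ∧ t.1 j = t.2.2 j) ∨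
          (t.2.2 j = j ∧ t.1 j = t.2.1 j)) ∧
        ¬(t.1 j = j ∧ t.2.1 j = j ∧ t.2.2 j = j)}

/-- The function `φ(t, n)` of Proposition 3.1. -/
noncomputable def phiFn (t : ℝ) (n : ℕ) : ℝ :=
  (1 - 2 * t / ((n : ℝ) + 2) + t ^ 2 / (((n : ℝ) + 1) * ((n : ℝ) + 2))) *
      ∑ k ∈ Finset.range (n + 1), t ^ k / (k.factorial : ℝ)
    + t ^ (n + 1) / ((n + 1).factorial : ℝ) - t ^ (n + 2) / ((n + 2).factorial : ℝ)

namespace DTriples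

open Finset

section Coloring

variable {α κ : Type*}

/-- For a permutation `σ` preserving the coloring `f`, the permutation that fixes the points of
color `i` and agrees with `σ` elsewhere. -/
def fixColor [DecidableEq κ] (f : α → κ) (σ : Equiv.Perm α) (h : ∀ j, f (σ j) = f j) (i : κ) :
    Equiv.Perm α where
  toFun j := if f j = i then j else σ j
  invFun j := if f j = i then j else σ.symm j
  left_inv j := by
    by_cases hj : f j = i <;> simp [hj, h]
  right_inv j := by
    have hs : f (σ.symm j) = f j := by simpa using (h (σ.symm j)).symm
    by_cases hj : f j = i <;> simp [hj, hs]

theorem fixColor_apply [DecidableEq κ] (f : α → κ) (σ : Equiv.Perm α) (h : ∀ j, f (σ j) = f j)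
    (i : κ) (j : α) : fixColor f σ h i j = if f j = i then j else σ j := rfl

/-- Each `j` is fixed by exactly one of the three permutations, and the other two agree at `j`. -/
def IsTriple (t : Equiv.Perm α × Equiv.Perm α × Equiv.Perm α) : Prop :=
  ∀ j : α,
    ((t.1 j = j ∧ t.2.1 j = t.2.2 j) ∨ (t.2.1 j = j ∧ t.1 j = t.2.2 j) ∨
        (t.2.2 j = j ∧ t.1 j = t.2.1 j)) ∧
      ¬(t.1 j = j ∧ t.2.1 j = j ∧ t.2.2 j = j)

/-- Derangements all of whose cycles are monochromatic for the coloring `f`. -/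
abbrev MonoDerangement (f : α → κ) : Type _ :=
  {σ : Equiv.Perm α // (∀ j, σ j ≠ j) ∧ ∀ j, f (σ j) = f j}

/-- The triple of permutations attached to a colored derangement. -/
def toTriple (p : Σ f : α → Fin 3, MonoDerangement f) :
    {t : Equiv.Perm α × Equiv.Perm α × Equiv.Perm α // IsTriple t} :=
  ⟨(fixColor p.1 p.2.1 p.2.2.2 0, fixColor p.1 p.2.1 p.2.2.2 1, fixColor p.1 p.2.1 p.2.2.2 2), by
    intro j
    have hd := p.2.2.1 j
    simp only [fixColor_apply]
    generalize p.1 j = c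
    fin_cases c <;> simp [hd]⟩

theorem toTriple_injective : Function.Injective (toTriple (α := α)) := by
  rintro ⟨f, σ, hσ, hf⟩ ⟨g, ρ, hρ, hg⟩ h
  simp only [toTriple, Subtype.ext_iff, Prod.ext_iff, Equiv.ext_iff, fixColor_apply] at h
  obtain ⟨h0, h1, h2⟩ := h
  have key : ∀ j, f j = g j ∧ σ j = ρ j := by
    intro j
    have a0 := h0 j
    have a1 := h1 j
    have a2 := h2 j
    have b := hσ j
    have c := hρ j
    have hx : f j = 0 ∨ f j = 1 ∨ f j = 2 := by lia
    have hy : g j = 0 ∨ g j = 1 ∨ g j = 2 := by lia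
    rcases hx with hx | hx | hx <;> rcases hy with hy | hy | hy <;>
      simp [hx, hy] at a0 a1 a2 ⊢ <;> grind
  obtain rfl : f = g := funext fun j => (key j).1
  obtain rfl : σ = ρ := Equiv.ext fun j => (key j).2
  rfl

theorem toTriple_surjective [Finite α] : Function.Surjective (toTriple (α := α)) := by
  classical
  rintro ⟨⟨τ₁, τ₂, τ₃⟩, ht⟩
  simp only [IsTriple] at ht
  have i₁ : ∀ a b, τ₁ a = τ₁ b → a = b := fun a b h => τ₁.injective h
  have i₂ : ∀ a b, τ₂ a = τ₂ b → a = b := fun a b h => τ₂.injective h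
  have i₃ : ∀ a b, τ₃ a = τ₃ b → a = b := fun a b h => τ₃.injective h
  let s : α → α := fun j => if τ₁ j = j then τ₂ j else τ₁ j
  let f : α → Fin 3 := fun j => if τ₁ j = j then 0 else if τ₂ j = j then 1 else 2
  have hfs : ∀ j, f (s j) = f j := by
    intro j
    have h1 := ht j
    have h2 := ht (s j)
    have := i₁ (s j) j
    have := i₂ (s j) j
    have := i₃ (s j) j
    simp only [f, s] at *
    split_ifs at * <;> grind
  have hs : Function.Injective s := by
    intro a b hab
    have hc : f a = f b := by rw [← hfs a, hab, hfs b]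
    have := i₁ a b
    have := i₂ a b
    simp only [f, s] at *
    split_ifs at * <;> grind
  refine ⟨⟨f, Equiv.ofBijective s (Finite.injective_iff_bijective.mp hs), ?_, hfs⟩, ?_⟩
  · intro j
    have := ht j
    simp only [Equiv.ofBijective_apply, s]
    split_ifs <;> grind
  · simp only [toTriple, Subtype.ext_iff, Prod.ext_iff, Equiv.ext_iff, fixColor_apply,
      Equiv.ofBijective_apply]
    refine ⟨fun j => ?_, fun j => ?_, fun j => ?_⟩ <;>
    · have := ht j
      simp only [f, s]
      split_ifs <;> grind

/-- A derangement with monochromatic cycles is a family of derangements of the color classes. -/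
def monoDerangementEquiv (f : α → κ) :
    MonoDerangement f ≃ ∀ i, derangements {a // f a = i} where
  toFun σ i := ⟨σ.1.subtypePerm fun a => by rw [σ.2.2 a], fun a h =>
    σ.2.1 a (congrArg Subtype.val h)⟩
  invFun g := ⟨DomMulAct.stabilizerEquiv_invFun_aux fun i => (g i).1,
    fun j h => (g (f j)).2 ⟨j, rfl⟩ (Subtype.ext h),
    fun j => DomMulAct.comp_stabilizerEquiv_invFun (fun i => (g i).1) j⟩
  left_inv _ := rfl
  right_inv g := by
    ext i a
    exact DomMulAct.stabilizerEquiv_invFun_eq (fun i => (g i).1) a.2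

theorem card_isTriple [Fintype α] [DecidableEq α] :
    Nat.card {t : Equiv.Perm α × Equiv.Perm α × Equiv.Perm α // IsTriple t} =
      ∑ f : α → Fin 3, ∏ i, numDerangements #{a | f a = i} := by
  rw [← Nat.card_eq_of_bijective _ ⟨toTriple_injective, toTriple_surjective⟩, Nat.card_sigma]
  refine sum_congr rfl fun f _ => ?_
  rw [Nat.card_congr (monoDerangementEquiv f), Nat.card_pi]
  refine prod_congr rfl fun i _ => ?_
  rw [Nat.card_eq_fintype_card, card_derangements_eq_numDerangements, Fintype.card_subtype]

theorem sum_coloring_three [Fintype α] [DecidableEq α] {R : Type*} [CommSemiring R] (g : ℕ → R) :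
    ∑ f : α → Fin 3, ∏ i, g #{a | f a = i} =
      ∑ A ∈ (univ : Finset α).powerset, ∑ B ∈ Aᶜ.powerset, g #A * (g #B * g (#Aᶜ - #B)) := by
  rw [sum_sigma']
  refine sum_bij' (fun f _ => ⟨({a | f a = 0} : Finset α), ({a | f a = 1} : Finset α)⟩)
    (fun p _ a => if a ∈ p.1 then 0 else if a ∈ p.2 then 1 else 2) ?_ ?_ ?_ ?_ ?_
  · intro f _
    simp only [mem_sigma, mem_powerset, subset_univ, true_and]
    intro a ha
    simp_all
  · simp
  · intro f _
    funext a
    simp only [mem_filter, mem_univ, true_and]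
    generalize f a = c
    fin_cases c <;> simp
  · rintro ⟨A, B⟩ h
    simp only [mem_sigma, mem_powerset, subset_univ, true_and] at h
    have h' : ∀ a ∈ B, a ∉ A := fun a ha => by simpa using h ha
    simp only [Sigma.mk.injEq, heq_eq_eq]
    constructor <;> ext a <;> have := h' a <;> by_cases hA : a ∈ A <;>
      by_cases hB : a ∈ B <;> simp_all
  · intro f _
    have hsub : ({a | f a = 1} : Finset α) ⊆ ({a | f a = 0} : Finset α)ᶜ := by
      intro a ha
      simp_all
    have h2 : ({a | f a = 2} : Finset α) =
        ({a | f a = 0} : Finset α)ᶜ \ ({a | f a = 1} : Finset α) := by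
      ext a
      simp only [mem_filter, mem_univ, true_and, mem_sdiff, mem_compl]
      generalize f a = c
      fin_cases c <;> simp
    rw [Fin.prod_univ_three, h2, card_sdiff_of_subset hsub, mul_assoc]

end Coloring

theorem dTriples_eq_sum (n : ℕ) :
    dTriples n = ∑ k ∈ range (n + 1), n.choose k * (numDerangements k *
      ∑ l ∈ range (n - k + 1), (n - k).choose l *
        (numDerangements l * numDerangements (n - k - l))) := by
  have h : dTriples n = Nat.card {t : Equiv.Perm (Fin n) × Equiv.Perm (Fin n) × Equiv.Perm (Fin n)
    // IsTriple t} := rfl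
  rw [h, card_isTriple, sum_coloring_three]
  simp_rw [← mul_sum]
  have inner (A : Finset (Fin n)) :
      ∑ B ∈ Aᶜ.powerset, numDerangements #B * numDerangements (#Aᶜ - #B) =
        ∑ l ∈ range (n - #A + 1), (n - #A).choose l *
          (numDerangements l * numDerangements (n - #A - l)) := by
    rw [sum_powerset_apply_card (fun m => numDerangements m * numDerangements (#Aᶜ - m))]
    simp [card_compl]
  simp_rw [inner]
  rw [sum_powerset_apply_card (fun m => numDerangements m * ∑ l ∈ range (n - m + 1),
    (n - m).choose l * (numDerangements l * numDerangements (n - m - l)))]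
  simp

section GeneratingFunction

open PowerSeries

/-- The exponential generating function of a sequence. -/
noncomputable def egf (a : ℕ → ℝ) : PowerSeries ℝ :=
  PowerSeries.mk fun n => a n / n.factorial

theorem coeff_egf_mul (a b : ℕ → ℝ) (n : ℕ) :
    (n.factorial : ℝ) * coeff n (egf a * egf b) =
      ∑ k ∈ range (n + 1), (n.choose k : ℝ) * (a k * b (n - k)) := by
  rw [coeff_mul, Nat.sum_antidiagonal_eq_sum_range_succ_mk, mul_sum]
  refine sum_congr rfl fun k hk => ?_
  have hk' : k ≤ n := Nat.lt_succ_iff.mp (mem_range.mp hk)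
  rw [Nat.cast_choose ℝ hk']
  simp only [egf, coeff_mk]
  field_simp

theorem egf_mul (a b : ℕ → ℝ) :
    egf a * egf b = egf fun n => ∑ k ∈ range (n + 1), (n.choose k : ℝ) * (a k * b (n - k)) := by
  ext n
  conv_rhs => rw [egf, coeff_mk, ← coeff_egf_mul]
  rw [mul_div_cancel_left₀ _ (by positivity)]

theorem egf_pow (t : ℝ) : egf (fun n => t ^ n) = rescale t (exp ℝ) := by
  ext n
  simp [egf, coeff_exp, div_eq_mul_inv]

theorem egf_numDerangements :
    egf (fun n => numDerangements n) = rescale (-1) (exp ℝ) * PowerSeries.mk 1 := by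
  have h : egf (fun n => numDerangements n) * (1 - X) = rescale (-1) (exp ℝ) := by
    rw [← egf_pow]
    ext n
    cases n with
    | zero => simp [egf, mul_sub]
    | succ n =>
      have hs : (numDerangements (n + 1) : ℝ) = (n + 1) * numDerangements n - (-1) ^ n := by
        exact_mod_cast numDerangements_succ n
      simp only [mul_sub, mul_one, map_sub, coeff_succ_mul_X, egf, coeff_mk, hs,
        Nat.factorial_succ]
      push_cast
      field_simp
      ring
  rw [← h, mul_assoc, mul_comm (1 - X), mk_one_mul_one_sub_eq_one, mul_one]

theorem egf_dTriples :
    egf (fun n => dTriples n) = egf (fun n => numDerangements n) *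
      (egf (fun n => numDerangements n) * egf (fun n => numDerangements n)) := by
  rw [egf_mul, egf_mul]
  congr 1
  funext n
  rw [dTriples_eq_sum]
  push_cast
  rfl

theorem egf_pow_mul_egf_dTriples (t : ℝ) :
    egf (fun n => t ^ n) * egf (fun n => dTriples n) =
      egf (fun n => (t - 3) ^ n) * PowerSeries.mk fun n => ((2 + n).choose 2 : ℝ) := by
  have hexp : rescale (t - 3) (exp ℝ) = rescale t (exp ℝ) * (rescale (-1) (exp ℝ) *
      (rescale (-1) (exp ℝ) * rescale (-1) (exp ℝ))) := by
    simp only [exp_mul_exp_eq_exp_add]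
    congr 1
    ring_nf
  rw [egf_dTriples, egf_numDerangements, egf_pow, egf_pow, ← mk_one_pow_eq_mk_choose_add ℝ 2, hexp]
  ring

end GeneratingFunction

theorem sum_dTriples (n : ℕ) (t : ℝ) :
    ∑ k ∈ range (n + 1), ((n.choose k : ℝ) * (dTriples (n - k) : ℝ)) * t ^ k =
      n.factorial / 2 * ∑ k ∈ range (n + 1),
        ((n + 1 - k : ℝ) * (n + 2 - k) * ((t - 3) ^ k / k.factorial)) := by
  have h := coeff_egf_mul (fun n => t ^ n) (fun n => dTriples n) n
  rw [egf_pow_mul_egf_dTriples, PowerSeries.coeff_mul,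
    Nat.sum_antidiagonal_eq_sum_range_succ_mk] at h
  calc _ = ∑ k ∈ range (n + 1), (n.choose k : ℝ) * (t ^ k * dTriples (n - k)) :=
        sum_congr rfl fun k _ => by ring
    _ = _ := by
      rw [← h, mul_sum, mul_sum]
      refine sum_congr rfl fun k hk => ?_
      have hk' : k ≤ n := Nat.lt_succ_iff.mp (mem_range.mp hk)
      simp only [egf, PowerSeries.coeff_mk, Nat.cast_choose_two]
      push_cast [hk']
      ring

theorem sum_mul_exp_terms (n : ℕ) (s : ℝ) :
    ∑ k ∈ range (n + 1), (k : ℝ) * (s ^ k / k.factorial) =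
      s * ∑ k ∈ range (n + 1), s ^ k / k.factorial - s ^ (n + 1) / n.factorial := by
  induction n with
  | zero => simp
  | succ n ih =>
    rw [sum_range_succ, ih, sum_range_succ _ (n + 1), Nat.factorial_succ]
    push_cast
    field_simp
    ring

theorem sum_mul_pred_mul_exp_terms (n : ℕ) (s : ℝ) :
    ∑ k ∈ range (n + 1), (k : ℝ) * (k - 1) * (s ^ k / k.factorial) =
      s ^ 2 * ∑ k ∈ range (n + 1), s ^ k / k.factorial -
        (s ^ (n + 2) + n * s ^ (n + 1)) / n.factorial := by
  induction n with
  | zero => simp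
  | succ n ih =>
    rw [sum_range_succ, ih, sum_range_succ _ (n + 1), Nat.factorial_succ]
    push_cast
    field_simp
    ring

theorem factorial_mul_phiFn (n : ℕ) (s : ℝ) :
    ((n + 2).factorial : ℝ) * phiFn s n =
      n.factorial * ∑ k ∈ range (n + 1),
        ((n + 1 - k : ℝ) * (n + 2 - k) * (s ^ k / k.factorial)) := by
  have hsplit : ∑ k ∈ range (n + 1), ((n + 1 - k : ℝ) * (n + 2 - k) * (s ^ k / k.factorial)) =
      (n + 1) * (n + 2) * ∑ k ∈ range (n + 1), s ^ k / k.factorial -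
        2 * (n + 1) * ∑ k ∈ range (n + 1), (k : ℝ) * (s ^ k / k.factorial) +
        ∑ k ∈ range (n + 1), (k : ℝ) * (k - 1) * (s ^ k / k.factorial) := by
    rw [mul_sum, mul_sum, ← sum_sub_distrib, ← sum_add_distrib]
    exact sum_congr rfl fun k _ => by ring
  rw [hsplit, sum_mul_exp_terms, sum_mul_pred_mul_exp_terms, phiFn, Nat.factorial_succ,
    Nat.factorial_succ]
  generalize ∑ k ∈ range (n + 1), s ^ k / (k.factorial : ℝ) = E
  push_cast
  field_simp
  ring

end DTriples

/-- With `d_{n,k} = C(n,k) d_{n−k}`, for every `n ≥ 1` and every real `t`,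
`Σ_{k=0}^{n} d_{n,k} t^k = ((n+2)!/2) φ(t − 3, n)`. -/
theorem dTriples_sum_eq_phi (n : ℕ) (hn : 1 ≤ n) (t : ℝ) :
    ∑ k ∈ Finset.range (n + 1),
        ((n.choose k : ℝ) * (dTriples (n - k) : ℝ)) * t ^ k =
      ((n + 2).factorial : ℝ) / 2 * phiFn (t - 3) n := by
  rw [DTriples.sum_dTriples, div_mul_eq_mul_div, div_mul_eq_mul_div, DTriples.factorial_mul_phiFn]
end

section
/- Let dₙ (for n ≥ 1) be the number of triples (τ₁, τ₂, τ₃) of permutations of {1, …, n} such that for each j, at least one of τ₁(j), τ₂(j), τ₃(j) equals j, the other two are equal to each other, and not all three equal j; set d₀ = 1. Then the exponential generating function of (dₙ) satisfies Σ_{n=0}^{∞} dₙ tⁿ/n! = e^{−3t} / (1 − t)³ for all real t with |t| < 1 (equivalently, as an identity of formal power series). -/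
/-- Products of exponential generating functions correspond to binomial convolution. -/
theorem HasSum.egf_mul {a b : ℕ → ℝ} {t A B : ℝ}
    (ha : HasSum (fun n => a n * t ^ n / (n.factorial : ℝ)) A)
    (hb : HasSum (fun n => b n * t ^ n / (n.factorial : ℝ)) B) :
    HasSum (fun n => (∑ k ∈ Finset.range (n + 1), (n.choose k : ℝ) * (a k * b (n - k))) * t ^ n /
      (n.factorial : ℝ)) (A * B) := by
  have h := hasSum_sum_range_mul_of_summable_norm ha.summable.norm hb.summable.norm
  rw [ha.tsum_eq, hb.tsum_eq] at h
  refine (congrArg (HasSum · _) (funext fun n => ?_)).mpr h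
  rw [Finset.sum_mul, Finset.sum_div]
  refine Finset.sum_congr rfl fun k hk => ?_
  have hkn : k ≤ n := Nat.lt_succ_iff.mp (Finset.mem_range.mp hk)
  rw [Nat.cast_choose ℝ hkn, ← Nat.add_sub_cancel' hkn, pow_add, Nat.add_sub_cancel' hkn]
  have h0 := Nat.cast_ne_zero (R := ℝ).mpr n.factorial_ne_zero
  field_simp

theorem numDerangements_eq_sum_choose (n : ℕ) :
    (numDerangements n : ℝ) = ∑ k ∈ Finset.range (n + 1),
      (n.choose k : ℝ) * ((-1) ^ k * ((n - k).factorial : ℝ)) := by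
  have h := congrArg (Int.cast : ℤ → ℝ) (numDerangements_sum n)
  push_cast at h
  rw [h]
  refine Finset.sum_congr rfl fun k hk => ?_
  have hkn : k ≤ n := Nat.lt_succ_iff.mp (Finset.mem_range.mp hk)
  have h1 := Nat.factorial_mul_ascFactorial k (n - k)
  rw [Nat.add_sub_cancel' hkn] at h1
  have h2 := Nat.choose_mul_factorial_mul_factorial hkn
  have h3 : (k + 1).ascFactorial (n - k) = n.choose k * (n - k).factorial :=
    Nat.eq_of_mul_eq_mul_left k.factorial_pos (by rw [h1, ← h2]; ring)
  rw [h3]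
  push_cast
  ring

theorem hasSum_numDerangements_egf {t : ℝ} (ht : |t| < 1) :
    HasSum (fun n : ℕ => (numDerangements n : ℝ) * t ^ n / (n.factorial : ℝ))
      (Real.exp (-t) / (1 - t)) := by
  have h1 : HasSum (fun n : ℕ => (-1 : ℝ) ^ n * t ^ n / (n.factorial : ℝ)) (Real.exp (-t)) := by
    have h := NormedSpace.expSeries_div_hasSum_exp (-t)
    rw [← Real.exp_eq_exp_ℝ] at h
    simpa only [← mul_pow, neg_one_mul] using h
  have h2 : HasSum (fun n : ℕ => (n.factorial : ℝ) * t ^ n / (n.factorial : ℝ)) (1 - t)⁻¹ := by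
    refine (congrArg (HasSum · _) (funext fun n => ?_)).mpr (hasSum_geometric_of_abs_lt_one ht)
    have h0 := Nat.cast_ne_zero (R := ℝ).mpr n.factorial_ne_zero
    field_simp
  simp only [numDerangements_eq_sum_choose]
  rw [div_eq_mul_inv]
  exact HasSum.egf_mul (a := fun n => (-1) ^ n) (b := fun n => (n.factorial : ℝ)) h1 h2

/-- Derangements preserving the fibres of `c` are families of derangements of the fibres. -/
def derangementsFiberEquiv {α ι : Type*} (c : α → ι) :
    {σ : Equiv.Perm α // (∀ j, σ j ≠ j) ∧ ∀ j, c (σ j) = c j} ≃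
      ∀ i, derangements {a // c a = i} where
  toFun σ i := ⟨σ.1.subtypePerm fun j => by rw [σ.2.2], fun j h =>
    σ.2.1 j (congrArg Subtype.val h)⟩
  invFun ρ := ⟨((Equiv.sigmaFiberEquiv c).symm.trans
      (Equiv.sigmaCongrRight fun i => (ρ i).1)).trans (Equiv.sigmaFiberEquiv c),
    fun j h => (ρ (c j)).2 ⟨j, rfl⟩ (Subtype.ext h), fun j => ((ρ (c j)).1 ⟨j, rfl⟩).2⟩
  left_inv σ := by ext j; rfl
  right_inv ρ := by
    funext i
    ext ⟨j, rfl⟩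
    rfl

/-- The permutation fixing the `i`-th fibre of `c` and agreeing with `σ` elsewhere. -/
def Equiv.Perm.fixFiber {α ι : Type*} [DecidableEq ι] (σ : Equiv.Perm α) (c : α → ι)
    (h : ∀ j, c (σ j) = c j) (i : ι) : Equiv.Perm α where
  toFun j := if c j = i then j else σ j
  invFun j := if c j = i then j else σ.symm j
  left_inv j := by by_cases hj : c j = i <;> simp [hj, h]
  right_inv j := by
    have hj' : c (σ.symm j) = c j := by simpa using (h (σ.symm j)).symm
    by_cases hj : c j = i <;> simp [hj, hj']

theorem Equiv.Perm.fixFiber_apply {α ι : Type*} [DecidableEq ι] (σ : Equiv.Perm α) (c : α → ι)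
    (h : ∀ j, c (σ j) = c j) (i : ι) (j : α) :
    σ.fixFiber c h i j = if c j = i then j else σ j := rfl

/-- The condition on triples of permutations counted by `dTriples`. -/
def IsDTriple {α : Type*} (t : Equiv.Perm α × Equiv.Perm α × Equiv.Perm α) : Prop :=
  ∀ j : α,
    ((t.1 j = j ∧ t.2.1 j = t.2.2 j) ∨ (t.2.1 j = j ∧ t.1 j = t.2.2 j) ∨
        (t.2.2 j = j ∧ t.1 j = t.2.1 j)) ∧
      ¬(t.1 j = j ∧ t.2.1 j = j ∧ t.2.2 j = j)

/-- The triple of permutations attached to a derangement and an invariant `3`-colouring. -/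
def tripleOfColouring {α : Type*}
    (p : (c : α → Fin 3) × {σ : Equiv.Perm α // (∀ j, σ j ≠ j) ∧ ∀ j, c (σ j) = c j}) :
    {t : Equiv.Perm α × Equiv.Perm α × Equiv.Perm α // IsDTriple t} :=
  ⟨(p.2.1.fixFiber p.1 p.2.2.2 0, p.2.1.fixFiber p.1 p.2.2.2 1, p.2.1.fixFiber p.1 p.2.2.2 2), by
    obtain ⟨c, σ, h1, h2⟩ := p
    intro j
    have h := h1 j
    simp only [Equiv.Perm.fixFiber_apply]
    generalize c j = i
    fin_cases i <;> simp [h]⟩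

theorem tripleOfColouring_injective {α : Type*} :
    Function.Injective (tripleOfColouring (α := α)) := by
  rintro ⟨c, σ, h1, h2⟩ ⟨c', σ', h1', h2'⟩ h
  simp only [tripleOfColouring, Subtype.mk.injEq, Prod.mk.injEq] at h
  obtain ⟨e0, e1, e2⟩ := h
  have key : ∀ j, c j = c' j ∧ σ j = σ' j := by
    intro j
    have e0 := DFunLike.congr_fun e0 j
    have e1 := DFunLike.congr_fun e1 j
    have e2 := DFunLike.congr_fun e2 j
    have h := h1 j
    have h' := h1' j
    simp only [Equiv.Perm.fixFiber_apply] at e0 e1 e2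
    generalize c j = i at *
    generalize c' j = i' at *
    fin_cases i <;> fin_cases i' <;> simp [h, h'.symm] at e0 e1 e2 ⊢ <;> assumption
  obtain rfl : c = c' := funext fun j => (key j).1
  obtain rfl : σ = σ' := Equiv.ext fun j => (key j).2
  rfl

theorem tripleOfColouring_surjective {α : Type*} [Finite α] :
    Function.Surjective (tripleOfColouring (α := α)) := by
  classical
  rintro ⟨⟨τ₁, τ₂, τ₃⟩, ht⟩
  have ht' := ht
  simp only [IsDTriple] at ht'
  have i1 : ∀ {x y}, τ₁ x = τ₁ y → x = y := fun h => τ₁.injective h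
  have i2 : ∀ {x y}, τ₂ x = τ₂ y → x = y := fun h => τ₂.injective h
  have i3 : ∀ {x y}, τ₃ x = τ₃ y → x = y := fun h => τ₃.injective h
  let s : α → α := fun j => if τ₁ j = j then τ₂ j else τ₁ j
  let c : α → Fin 3 := fun j => if τ₁ j = j then 0 else if τ₂ j = j then 1 else 2
  have hs : Function.Injective s := by
    intro x y h
    have hx := ht' x
    have hy := ht' y
    simp only [s] at h
    grind
  let σ : Equiv.Perm α := Equiv.ofBijective s (Finite.injective_iff_bijective.mp hs)
  have hσ : ∀ j, σ j = if τ₁ j = j then τ₂ j else τ₁ j := fun j => rfl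
  have h1 : ∀ j, σ j ≠ j := by
    intro j
    have hj := ht' j
    rw [hσ]
    grind
  have h2 : ∀ j, c (σ j) = c j := by
    intro j
    have hj := ht' j
    have hj' := ht' (σ j)
    have := h1 j
    have := hσ j
    simp only [c]
    grind
  refine ⟨⟨c, σ, h1, h2⟩, Subtype.ext (Prod.ext ?_ (Prod.ext ?_ ?_))⟩ <;>
  · ext j
    have hj := ht' j
    simp only [tripleOfColouring, Equiv.Perm.fixFiber_apply, hσ, c]
    grind

theorem dTriples_eq_sum_colourings (n : ℕ) :
    dTriples n = ∑ c : Fin n → Fin 3, ∏ i, numDerangements (Fintype.card {a // c a = i}) := by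
  have h : dTriples n = Nat.card ((c : Fin n → Fin 3) × ∀ i, derangements {a // c a = i}) :=
    (Nat.card_congr ((Equiv.sigmaCongrRight fun c => (derangementsFiberEquiv c).symm).trans
      (Equiv.ofBijective _
        ⟨tripleOfColouring_injective, tripleOfColouring_surjective⟩))).symm
  rw [h, Nat.card_sigma]
  refine Finset.sum_congr rfl fun c _ => ?_
  rw [Nat.card_pi]
  refine Finset.prod_congr rfl fun i _ => ?_
  rw [Nat.card_eq_fintype_card, card_derangements_eq_numDerangements]

/-- A sum over `3`-colourings of fibre cardinalities, organised by the successive fibres. -/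
theorem sum_colourings_eq_sum_choose {R : Type*} [CommSemiring R] (f : ℕ → R) (n : ℕ) :
    ∑ c : Fin n → Fin 3, ∏ i, f (Fintype.card {a // c a = i}) =
      ∑ k ∈ Finset.range (n + 1), (n.choose k : R) * (f k *
        ∑ l ∈ Finset.range (n - k + 1), ((n - k).choose l : R) * (f l * f (n - k - l))) := by
  have inner (S : Finset (Fin n)) :
      ∑ l ∈ Finset.range (n - S.card + 1),
          ((n - S.card).choose l : R) * (f l * f (n - S.card - l)) =
        ∑ T ∈ Sᶜ.powerset, f T.card * f (n - S.card - T.card) := by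
    rw [Finset.sum_powerset_apply_card fun l => f l * f (n - S.card - l), Finset.card_compl,
      Fintype.card_fin]
    simp only [nsmul_eq_mul]
  have outer := Finset.sum_powerset_apply_card (x := (Finset.univ : Finset (Fin n))) (fun k =>
    f k *
    ∑ l ∈ Finset.range (n - k + 1), ((n - k).choose l : R) * (f l * f (n - k - l)))
  simp only [nsmul_eq_mul, Finset.card_univ, Fintype.card_fin] at outer
  rw [← outer]
  simp only [inner, Finset.mul_sum]
  rw [Finset.sum_sigma']
  refine Finset.sum_bij' (fun c _ => ⟨Finset.univ.filter (c · = 0), Finset.univ.filter (c · = 1)⟩)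
    (fun p _ a => if a ∈ p.1 then 0 else if a ∈ p.2 then 1 else 2) ?_ ?_ ?_ ?_ ?_
  · intro c _
    simp only [Finset.mem_sigma, Finset.mem_powerset, Finset.subset_univ, true_and]
    intro a
    simp +contextual
  · simp
  · intro c _
    funext a
    simp only [Finset.mem_filter, Finset.mem_univ, true_and]
    generalize c a = i
    fin_cases i <;> rfl
  · rintro ⟨S, T⟩ h
    have hT : ∀ a ∈ T, a ∉ S := by
      intro a ha
      have hmem := Finset.mem_powerset.mp (Finset.mem_sigma.mp h).2 ha
      simpa using hmem
    simp only [Sigma.mk.injEq, heq_eq_eq]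
    constructor <;> ext a <;> have := hT a <;> by_cases h1 : a ∈ S <;> by_cases h2 : a ∈ T <;>
      simp_all
  · intro c _
    have h : ∑ i, (Finset.univ.filter (c · = i)).card = n := by
      simpa using (Finset.card_eq_sum_card_fiberwise (f := c) (s := Finset.univ)
        (t := Finset.univ) (by simp)).symm
    rw [Fin.sum_univ_three] at h
    simp only [Fin.prod_univ_three, Fintype.card_subtype]
    rw [mul_assoc]
    congr 3
    omega

/-- The exponential generating function of `(dₙ)`:
`Σ_{n=0}^{∞} dₙ tⁿ/n! = e^{−3t} / (1 − t)³` for `|t| < 1`. -/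
theorem dTriples_egf (t : ℝ) (ht : |t| < 1) :
    HasSum (fun n : ℕ => (dTriples n : ℝ) * t ^ n / (n.factorial : ℝ))
      (Real.exp (-3 * t) / (1 - t) ^ 3) := by
  have hD := hasSum_numDerangements_egf ht
  have h := hD.egf_mul (hD.egf_mul hD)
  have hn (n : ℕ) := congrArg (Nat.cast : ℕ → ℝ) (dTriples_eq_sum_colourings n)
  push_cast at hn
  simp only [hn, sum_colourings_eq_sum_choose (fun m => (numDerangements m : ℝ))]
  convert h using 1
  rw [show -3 * t = -t + (-t + -t) by ring, Real.exp_add, Real.exp_add]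
  rw [div_mul_div_comm, div_mul_div_comm]
  ring
end

section
/- Let K be a symmetric convex body in ℝⁿ and let 0 < p < ∞. Then ‖V_K‖_p ≤ (1 + p/n)^{−n/p} ‖V_K‖_∞, where ‖V_K‖_∞ denotes the essential supremum of V_K. -/
open MeasureTheory Pointwise

/-- The uniform probability measure on a set `K` in `ℝⁿ`. -/
noncomputable def unifMeasure (n : ℕ) (K : Set (EuclideanSpace ℝ (Fin n))) :
    Measure (EuclideanSpace ℝ (Fin n)) :=
  (volume K)⁻¹ • volume.restrict K

/-- The joint distribution of `N` independent uniform random points in `K`. -/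
noncomputable def jointUnif (n N : ℕ) (K : Set (EuclideanSpace ℝ (Fin n))) :
    Measure (Fin N → EuclideanSpace ℝ (Fin n)) :=
  Measure.pi fun _ => unifMeasure n K

/-- `V_K`: the normalized volume of the symmetric convex hull of `n` points. -/
noncomputable def randCrossVol (n : ℕ) (K : Set (EuclideanSpace ℝ (Fin n)))
    (x : Fin n → EuclideanSpace ℝ (Fin n)) : ℝ :=
  (volume (convexHull ℝ (Set.range x ∪ -Set.range x))).toReal / (volume K).toReal

section Determinant

variable {n : ℕ} (K : Set (EuclideanSpace ℝ (Fin n)))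

lemma randCrossVol_eq_abs_det (x : Fin n → EuclideanSpace ℝ (Fin n)) :
    randCrossVol n K x = |(EuclideanSpace.basisFun (Fin n) ℝ).toBasis.det x| *
      randCrossVol n K (EuclideanSpace.basisFun (Fin n) ℝ).toBasis := by
  set b := (EuclideanSpace.basisFun (Fin n) ℝ).toBasis with hb
  set A : EuclideanSpace ℝ (Fin n) →ₗ[ℝ] EuclideanSpace ℝ (Fin n) := b.constr ℝ x with hA
  have hAb : A ∘ b = x := by
    ext1 i
    simp [hA]
  have hdet : b.det x = LinearMap.det A := by
    conv_lhs => rw [← hAb, b.det_comp, b.det_self, mul_one]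
  have himage : A '' convexHull ℝ (Set.range b ∪ -Set.range b) =
      convexHull ℝ (Set.range x ∪ -Set.range x) := by
    rw [A.image_convexHull, Set.image_union, Set.image_neg, ← Set.range_comp, hAb]
  unfold randCrossVol
  rw [← himage, Measure.addHaar_image_linearMap, ENNReal.toReal_mul,
    ENNReal.toReal_ofReal (abs_nonneg _), hdet, mul_div_assoc]

lemma randCrossVol_nonneg (x : Fin n → EuclideanSpace ℝ (Fin n)) : 0 ≤ randCrossVol n K x := by
  unfold randCrossVol
  positivity

lemma continuous_randCrossVol : Continuous (randCrossVol n K) := by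
  rw [show randCrossVol n K = _ from funext (randCrossVol_eq_abs_det K)]
  refine Continuous.mul (Continuous.abs ?_) continuous_const
  refine Continuous.matrix_det (A := fun x => Module.Basis.toMatrix _ x) (continuous_matrix fun i j => ?_)
  simp only [Module.Basis.toMatrix_apply, OrthonormalBasis.coe_toBasis_repr_apply,
    EuclideanSpace.basisFun_repr]
  fun_prop

lemma randCrossVol_smul (t : Fin n → ℝ) (y : Fin n → EuclideanSpace ℝ (Fin n)) :
    randCrossVol n K (fun i => t i • y i) = |∏ i, t i| * randCrossVol n K y := by
  rw [randCrossVol_eq_abs_det, randCrossVol_eq_abs_det K y, ← mul_assoc, ← abs_mul,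
    ← smul_eq_mul (∏ i, t i)]
  congr 2
  exact MultilinearMap.map_smul_univ
    (EuclideanSpace.basisFun (Fin n) ℝ).toBasis.det.toMultilinearMap t y

variable {K}

lemma randCrossVol_le_one (hK_conv : Convex ℝ K) (hK_comp : IsCompact K) (hK_symm : K = -K)
    {x : Fin n → EuclideanSpace ℝ (Fin n)} (hx : ∀ i, x i ∈ K) : randCrossVol n K x ≤ 1 := by
  refine div_le_one_of_le₀ (ENNReal.toReal_mono hK_comp.measure_ne_top (measure_mono ?_))
    ENNReal.toReal_nonneg
  refine convexHull_min (Set.union_subset ?_ ?_) hK_conv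
  · rintro _ ⟨i, rfl⟩
    exact hx i
  · rw [hK_symm, Set.neg_subset_neg]
    rintro _ ⟨i, rfl⟩
    exact hx i

end Determinant

section ConvexBody

lemma Convex.zero_mem_interior_of_eq_neg {E : Type*} [NormedAddCommGroup E] [NormedSpace ℝ E]
    {K : Set E} (hconv : Convex ℝ K) (hint : (interior K).Nonempty) (hsymm : K = -K) :
    (0 : E) ∈ interior K := by
  obtain ⟨y, hy⟩ := hint
  have hy' : -y ∈ interior K := by
    have h := (Homeomorph.neg E).preimage_interior K
    rw [Homeomorph.coe_neg, Set.neg_preimage, Set.neg_preimage, ← hsymm] at h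
    rw [← h]
    simpa using hy
  have := hconv.interior hy hy' (a := 1 / 2) (b := 1 / 2) (by norm_num) (by norm_num) (by norm_num)
  simpa using this

lemma exists_gauge_smul_eq {E : Type*} [NormedAddCommGroup E] [NormedSpace ℝ E] {K : Set E}
    (hconv : Convex ℝ K) (hcomp : IsCompact K) (h0 : K ∈ nhds 0) (x : E) :
    ∃ y ∈ K, gauge K x • y = x := by
  by_cases hx : gauge K x = 0
  · refine ⟨0, mem_of_mem_nhds h0, ?_⟩
    rw [gauge_eq_zero (absorbent_nhds_zero h0)
      (NormedSpace.isVonNBounded_of_isBounded ℝ hcomp.isBounded)] at hx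
    simp [hx]
  · refine ⟨(gauge K x)⁻¹ • x, ?_, smul_inv_smul₀ hx x⟩
    refine hcomp.isClosed.closure_subset ((gauge_le_one_iff_mem_closure hconv h0).1 (le_of_eq ?_))
    rw [gauge_smul_of_nonneg (inv_nonneg.2 (gauge_nonneg _)), smul_eq_mul, inv_mul_cancel₀ hx]

end ConvexBody

section UniformMeasure

variable {n : ℕ} {K : Set (EuclideanSpace ℝ (Fin n))}

lemma isProbabilityMeasure_unifMeasure (h0 : volume K ≠ 0) (htop : volume K ≠ ⊤) :
    IsProbabilityMeasure (unifMeasure n K) :=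
  ⟨by simp [unifMeasure, ENNReal.inv_mul_cancel h0 htop]⟩

lemma ae_mem_unifMeasure (hK : MeasurableSet K) : ∀ᵐ x ∂unifMeasure n K, x ∈ K :=
  Measure.ae_smul_measure (ae_restrict_mem hK) _

lemma rpow_le_unifMeasure_gauge_le (h0 : volume K ≠ 0) (htop : volume K ≠ ⊤)
    (hconv : Convex ℝ K) (hK0 : (0 : EuclideanSpace ℝ (Fin n)) ∈ K) {s : ℝ} (hs : 0 ≤ s)
    (hs1 : s ≤ 1) : s ^ n ≤ (unifMeasure n K).real {x | gauge K x ≤ s} := by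
  have := isProbabilityMeasure_unifMeasure h0 htop
  have hsub : s • K ⊆ K := by
    rintro _ ⟨x, hx, rfl⟩
    exact hconv.smul_mem_of_zero_mem hK0 hx ⟨hs, hs1⟩
  have hle : s • K ⊆ {x | gauge K x ≤ s} := fun x hx => gauge_le_of_mem hs hx
  refine le_trans (le_of_eq ?_) (measureReal_mono hle)
  rw [measureReal_def, unifMeasure, Measure.smul_apply, smul_eq_mul,
    Measure.restrict_eq_self _ hsub, Measure.addHaar_smul, finrank_euclideanSpace_fin,
    mul_left_comm, ENNReal.inv_mul_cancel h0 htop, mul_one,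
    ENNReal.toReal_ofReal (abs_nonneg _), abs_of_nonneg (by positivity)]

lemma integrable_gauge_rpow_unifMeasure (h0 : volume K ≠ 0) (htop : volume K ≠ ⊤)
    (hK : MeasurableSet K) (hconv : Convex ℝ K) (hK0 : K ∈ nhds 0) {p : ℝ} (hp : 0 ≤ p) :
    Integrable (fun x => gauge K x ^ p) (unifMeasure n K) := by
  have := isProbabilityMeasure_unifMeasure h0 htop
  have hcont : Continuous fun x => gauge K x ^ p :=
    (continuous_gauge hconv hK0).rpow_const fun _ => Or.inr hp
  refine Integrable.of_bound hcont.aestronglyMeasurable 1 ?_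
  filter_upwards [ae_mem_unifMeasure hK] with x hx
  rw [Real.norm_of_nonneg (Real.rpow_nonneg (gauge_nonneg _) _)]
  exact Real.rpow_le_one (gauge_nonneg _) (gauge_le_one_of_mem hx) hp

lemma integral_gauge_rpow_unifMeasure_le (h0 : volume K ≠ 0) (htop : volume K ≠ ⊤)
    (hK : MeasurableSet K) (hconv : Convex ℝ K) (hK0 : K ∈ nhds 0) {p : ℝ} (hp : 0 < p) :
    ∫ x, gauge K x ^ p ∂unifMeasure n K ≤ 1 - (n / p + 1)⁻¹ := by
  have := isProbabilityMeasure_unifMeasure h0 htop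
  have hint := integrable_gauge_rpow_unifMeasure h0 htop hK hconv hK0 hp.le
  have hlayer := ((integrable_const (1 : ℝ)).sub hint).integral_eq_integral_Ioc_meas_le (M := 1)
    (by
      filter_upwards [ae_mem_unifMeasure hK] with x hx
      simpa using Real.rpow_le_one (gauge_nonneg _) (gauge_le_one_of_mem hx) hp.le)
    (.of_forall fun x => by simpa using Real.rpow_nonneg (gauge_nonneg _) _)
  simp only [Pi.sub_apply] at hlayer
  rw [integral_sub (integrable_const _) hint] at hlayer
  simp only [integral_const, probReal_univ, smul_eq_mul, mul_one] at hlayer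
  have hvalue : ∫ t in Set.Ioc (0 : ℝ) 1, (1 - t) ^ (n / p : ℝ) = (n / p + 1)⁻¹ := by
    have hnp : (0 : ℝ) ≤ n / p := by positivity
    rw [← intervalIntegral.integral_of_le zero_le_one,
      intervalIntegral.integral_comp_sub_left (fun t : ℝ => t ^ (n / p : ℝ)),
      integral_rpow (Or.inl (by linarith))]
    simp [Real.zero_rpow (by positivity : (n / p + 1 : ℝ) ≠ 0)]
  have hmono : ∫ t in Set.Ioc (0 : ℝ) 1, (1 - t) ^ (n / p : ℝ) ≤
      ∫ t in Set.Ioc (0 : ℝ) 1, (unifMeasure n K).real {x | t ≤ 1 - gauge K x ^ p} := by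
    refine setIntegral_mono_on ?_ ?_ measurableSet_Ioc fun t ht => ?_
    · refine (Continuous.integrableOn_Icc ?_).mono_set Set.Ioc_subset_Icc_self
      exact (continuous_const.sub continuous_id).rpow_const fun _ => Or.inr (by positivity)
    · have hanti : Antitone fun t : ℝ =>
          (unifMeasure n K).real {x | t ≤ 1 - gauge K x ^ p} := fun s t hst =>
        measureReal_mono fun x (hx : t ≤ _) => hst.trans hx
      exact ((hanti.antitoneOn _).integrableOn_isCompact isCompact_Icc).mono_set
        Set.Ioc_subset_Icc_self
    · have h1t : 0 ≤ 1 - t := by linarith [ht.2]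
      calc (1 - t) ^ (n / p : ℝ) = ((1 - t) ^ p⁻¹) ^ n := by
            rw [← Real.rpow_natCast, ← Real.rpow_mul h1t, inv_mul_eq_div]
        _ ≤ (unifMeasure n K).real {x | gauge K x ≤ (1 - t) ^ p⁻¹} :=
            rpow_le_unifMeasure_gauge_le h0 htop hconv (mem_of_mem_nhds hK0)
              (Real.rpow_nonneg h1t _)
              (Real.rpow_le_one h1t (by linarith [ht.1]) (by positivity))
        _ = _ := by
            congr 1
            ext x
            simp only [Set.mem_ofPred_eq]
            rw [Real.le_rpow_inv_iff_of_pos (gauge_nonneg _) h1t hp]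
            constructor <;> intro h <;> linarith
  linarith

lemma le_of_ae_jointUnif_le {N : ℕ} (htop : volume K ≠ ⊤)
    (hconv : Convex ℝ K) (hint : (interior K).Nonempty)
    {f : (Fin N → EuclideanSpace ℝ (Fin n)) → ℝ} (hf : Continuous f) {M : ℝ}
    (hM : ∀ᵐ x ∂jointUnif n N K, f x ≤ M) {x : Fin N → EuclideanSpace ℝ (Fin n)}
    (hx : ∀ i, x i ∈ K) : f x ≤ M := by
  have h0 : volume K ≠ 0 := (Measure.measure_pos_of_nonempty_interior _ hint).ne'
  have := isProbabilityMeasure_unifMeasure h0 htop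
  have hx' : x ∈ closure (Set.univ.pi fun _ : Fin N => interior K) := by
    rw [closure_pi_set]
    intro i _
    rw [hconv.closure_interior_eq_closure_of_nonempty_interior hint]
    exact subset_closure (hx i)
  by_contra! hlt
  have hopen : IsOpen {y | M < f y} := isOpen_lt continuous_const hf
  obtain ⟨y, hyM, hyK⟩ := mem_closure_iff.1 hx' _ hopen hlt
  obtain ⟨u, hu, hsub⟩ := isOpen_pi_iff'.1 hopen y hyM
  have hzero : jointUnif n N K (Set.univ.pi u) = 0 :=
    measure_mono_null (fun z hz => not_le.2 (hsub hz)) (ae_iff.1 hM)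
  rw [jointUnif, Measure.pi_pi, Finset.prod_eq_zero_iff] at hzero
  obtain ⟨i, -, hi⟩ := hzero
  rw [unifMeasure, Measure.smul_apply, smul_eq_mul, mul_eq_zero, ENNReal.inv_eq_zero] at hi
  have hpos : 0 < volume (u i ∩ interior K) :=
    ((hu i).1.inter isOpen_interior).measure_pos _ ⟨y i, (hu i).2, hyK i trivial⟩
  refine hpos.ne' (measure_mono_null ?_
    ((Measure.restrict_apply (hu i).1.measurableSet).symm.trans (hi.resolve_left htop)))
  exact Set.inter_subset_inter_right _ interior_subset

end UniformMeasure

/-- For a symmetric convex body `K ⊆ ℝⁿ` and `0 < p < ∞`,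
`‖V_K‖_p ≤ (1 + p/n)^{−n/p} ‖V_K‖_∞`. -/
theorem lpNorm_randCrossVol_le_essSup
    (n : ℕ) (hn : 0 < n)
    (K : Set (EuclideanSpace ℝ (Fin n)))
    (hK_conv : Convex ℝ K) (hK_comp : IsCompact K)
    (hK_int : (interior K).Nonempty) (hK_symm : K = -K)
    (p : ℝ) (hp : 0 < p) :
    (∫ x, |randCrossVol n K x| ^ p ∂(jointUnif n n K)) ^ (1 / p) ≤
      (1 + p / (n : ℝ)) ^ (-((n : ℝ) / p)) *
        essSup (fun x => |randCrossVol n K x|) (jointUnif n n K) := by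
  have h0 : volume K ≠ 0 := (Measure.measure_pos_of_nonempty_interior _ hK_int).ne'
  have htop : volume K ≠ ⊤ := hK_comp.measure_ne_top
  have hmeas : MeasurableSet K := hK_comp.measurableSet
  have hK0 : K ∈ nhds 0 :=
    mem_interior_iff_mem_nhds.1 (hK_conv.zero_mem_interior_of_eq_neg hK_int hK_symm)
  have := isProbabilityMeasure_unifMeasure h0 htop
  have hn' : (0 : ℝ) < n := Nat.cast_pos.2 hn
  simp only [abs_of_nonneg (randCrossVol_nonneg K _)]
  set M := essSup (fun x => randCrossVol n K x) (jointUnif n n K) with hM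
  have hae_mem : ∀ᵐ x ∂jointUnif n n K, ∀ i, x i ∈ K := ae_all_iff.2 fun i =>
    (Measure.quasiMeasurePreserving_eval _ i).ae (ae_mem_unifMeasure hmeas)
  have hbdd : ∀ᵐ x ∂jointUnif n n K, randCrossVol n K x ≤ M :=
    ae_le_essSup ⟨1, by
      rw [Filter.eventually_map]
      filter_upwards [hae_mem] with x hx using randCrossVol_le_one hK_conv hK_comp hK_symm hx⟩
  have hle : ∀ y : Fin n → EuclideanSpace ℝ (Fin n), (∀ i, y i ∈ K) → randCrossVol n K y ≤ M :=
    fun y hy => le_of_ae_jointUnif_le htop hK_conv hK_int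
      (continuous_randCrossVol K) hbdd hy
  have hM0 : 0 ≤ M :=
    (randCrossVol_nonneg K 0).trans (hle 0 fun _ => mem_of_mem_nhds hK0)
  have hgauge : ∀ x, randCrossVol n K x ^ p ≤ M ^ p * ∏ i, gauge K (x i) ^ p := fun x => by
    choose y hyK hy using fun i => exists_gauge_smul_eq hK_conv hK_comp hK0 (x i)
    have hprod : 0 ≤ ∏ i, gauge K (x i) := Finset.prod_nonneg fun i _ => gauge_nonneg _
    rw [Real.finsetProd_rpow _ _ fun i _ => gauge_nonneg _, ← Real.mul_rpow hM0 hprod]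
    refine Real.rpow_le_rpow (randCrossVol_nonneg K x) ?_ hp.le
    calc randCrossVol n K x = randCrossVol n K fun i => gauge K (x i) • y i := by simp only [hy]
      _ = (∏ i, gauge K (x i)) * randCrossVol n K y := by
          rw [randCrossVol_smul, abs_of_nonneg hprod]
      _ ≤ M * ∏ i, gauge K (x i) := by
          rw [mul_comm]
          gcongr
          exact hle y hyK
  have hint := integrable_gauge_rpow_unifMeasure h0 htop hmeas hK_conv hK0 hp.le
  have hfactor : 1 - (n / p + 1 : ℝ)⁻¹ = (1 + p / n)⁻¹ := by
    field_simp
    ring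
  have hmoment : ∫ x, randCrossVol n K x ^ p ∂jointUnif n n K ≤ M ^ p * ((1 + p / n)⁻¹) ^ n := by
    calc ∫ x, randCrossVol n K x ^ p ∂jointUnif n n K
        ≤ ∫ x, M ^ p * ∏ i, gauge K (x i) ^ p ∂jointUnif n n K :=
          integral_mono_of_nonneg
            (.of_forall fun x => Real.rpow_nonneg (randCrossVol_nonneg K x) p)
            ((Integrable.fintype_prod (f := fun _ z => gauge K z ^ p) fun _ => hint).const_mul _)
            (.of_forall hgauge)
      _ = M ^ p * (∫ z, gauge K z ^ p ∂unifMeasure n K) ^ n := by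
          rw [integral_const_mul, jointUnif,
            integral_fintype_prod_eq_prod (fun _ z => gauge K z ^ p)]
          simp
      _ ≤ M ^ p * ((1 + p / n)⁻¹) ^ n := by
          have hnonneg : 0 ≤ ∫ z, gauge K z ^ p ∂unifMeasure n K :=
            integral_nonneg fun z => Real.rpow_nonneg (gauge_nonneg _) p
          gcongr
          exact (integral_gauge_rpow_unifMeasure_le h0 htop hmeas hK_conv hK0 hp).trans_eq hfactor
  have hbase : 0 < 1 + p / (n : ℝ) := by positivity
  calc (∫ x, randCrossVol n K x ^ p ∂jointUnif n n K) ^ (1 / p)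
      ≤ (M ^ p * ((1 + p / n)⁻¹) ^ n) ^ (1 / p) :=
        Real.rpow_le_rpow
          (integral_nonneg fun x => Real.rpow_nonneg (randCrossVol_nonneg K x) p) hmoment
          (by positivity)
    _ = (1 + p / n) ^ (-(n / p : ℝ)) * M := by
        rw [Real.mul_rpow (by positivity) (by positivity), ← Real.rpow_mul hM0,
          mul_one_div_cancel hp.ne', Real.rpow_one, mul_comm, inv_pow, ← Real.rpow_natCast,
          ← Real.rpow_neg hbase.le, ← Real.rpow_mul hbase.le, neg_mul, mul_one_div]
end

section
/- For 1 ≤ q ≤ 2, ‖V_{B_qⁿ}‖_∞ = |B₁ⁿ| / |B_qⁿ|; that is, the essential supremum of the normalized volume of a random crosspolytope in B_qⁿ equals the ratio of the volume of the cross-polytope B₁ⁿ to the volume of B_qⁿ. -/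
open MeasureTheory Pointwise

/-- The unit ball of `ℓ_qⁿ`: `B_qⁿ = { x ∈ ℝⁿ : Σ |x_i|^q ≤ 1 }`. -/
noncomputable def lqBall (n : ℕ) (q : ℝ) : Set (EuclideanSpace ℝ (Fin n)) :=
  {x | ∑ i, |x i| ^ q ≤ 1}

open Set

/-- Hadamard's inequality for the determinant with respect to an orthonormal basis. -/
theorem OrthonormalBasis.abs_det_le_prod_norm {n : ℕ} {E : Type*} [NormedAddCommGroup E]
    [InnerProductSpace ℝ E] (b : OrthonormalBasis (Fin n) ℝ E) (v : Fin n → E) :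
    |b.toBasis.det v| ≤ ∏ i, ‖v i‖ := by
  have : Fact (Module.finrank ℝ E = n) :=
    ⟨by simpa using Module.finrank_eq_card_basis b.toBasis⟩
  rw [← b.toBasis.orientation.volumeForm_robust' b v]
  exact b.toBasis.orientation.abs_volumeForm_apply_le v

theorem convexHull_basisFun_union_neg {n : ℕ} (hn : 0 < n) :
    convexHull ℝ (range (EuclideanSpace.basisFun (Fin n) ℝ) ∪
      -range (EuclideanSpace.basisFun (Fin n) ℝ)) = lqBall n 1 := by
  set b := EuclideanSpace.basisFun (Fin n) ℝ with hb
  set S := range b ∪ -range b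
  apply Subset.antisymm
  · apply convexHull_min
    · have hbasis (i : Fin n) : ∑ j, |b i j| ≤ 1 := by
        simp [hb, apply_ite abs]
      rintro x (⟨i, rfl⟩ | hx)
      · simpa [lqBall] using hbasis i
      · obtain ⟨i, hi⟩ := hx
        have hxi : x = -b i := by rw [hi, neg_neg]
        simpa [lqBall, hxi] using hbasis i
    · intro x hx y hy s t hs ht hst
      simp only [lqBall, Real.rpow_one, mem_ofPred_eq] at hx hy ⊢
      calc ∑ i, |(s • x + t • y) i| ≤ ∑ i, (s * |x i| + t * |y i|) := by
            gcongr with i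
            simpa [abs_mul, abs_of_nonneg hs, abs_of_nonneg ht] using
              abs_add_le (s * x i) (t * y i)
        _ = s * ∑ i, |x i| + t * ∑ i, |y i| := by
            rw [Finset.sum_add_distrib, Finset.mul_sum, Finset.mul_sum]
        _ ≤ s * 1 + t * 1 := by gcongr
        _ = 1 := by linarith
  · intro x hx
    simp only [lqBall, Real.rpow_one, mem_ofPred_eq] at hx
    have hpos (i : Fin n) : b i ∈ convexHull ℝ S :=
      subset_convexHull ℝ S (Or.inl (mem_range_self i))
    have hneg (i : Fin n) : -b i ∈ convexHull ℝ S :=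
      subset_convexHull ℝ S (Or.inr (by simp))
    have hconv : Convex ℝ (convexHull ℝ S) := convex_convexHull ℝ S
    have hzero : (0 : EuclideanSpace ℝ (Fin n)) ∈ convexHull ℝ S := by
      have h := hconv (hpos ⟨0, hn⟩) (hneg ⟨0, hn⟩) (a := 1 / 2) (b := 1 / 2)
        (by norm_num) (by norm_num) (by norm_num)
      simpa using h
    let w : Option (Fin n) → ℝ := fun o => o.elim (1 - ∑ i, |x i|) fun i => |x i|
    let z : Option (Fin n) → EuclideanSpace ℝ (Fin n) :=
      fun o => o.elim 0 fun i => if 0 ≤ x i then b i else -b i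
    have hmem : ∑ o, w o • z o ∈ convexHull ℝ S := by
      refine hconv.sum_mem ?_ ?_ ?_
      · rintro (_ | i) -
        · simpa [w] using hx
        · simp [w]
      · simp [w, Fintype.sum_option]
      · rintro (_ | i) -
        · exact hzero
        · simp only [z, Option.elim_some]
          split_ifs
          exacts [hpos i, hneg i]
    convert hmem
    rw [Fintype.sum_option]
    simp only [w, z, Option.elim_none, Option.elim_some, smul_zero, zero_add]
    conv_lhs => rw [← b.sum_repr x]
    refine Finset.sum_congr rfl fun i _ => ?_
    split_ifs with h
    · simp [hb, abs_of_nonneg h]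
    · simp [hb, abs_of_neg (not_le.mp h)]

theorem volume_convexHull_range_union_neg {n : ℕ} (hn : 0 < n)
    (x : Fin n → EuclideanSpace ℝ (Fin n)) :
    volume (convexHull ℝ (range x ∪ -range x)) =
      ENNReal.ofReal |(EuclideanSpace.basisFun (Fin n) ℝ).toBasis.det x| *
        volume (lqBall n 1) := by
  set b := EuclideanSpace.basisFun (Fin n) ℝ with hb
  let L : EuclideanSpace ℝ (Fin n) →ₗ[ℝ] EuclideanSpace ℝ (Fin n) := b.toBasis.constr ℝ x
  have hL : L ∘ b = x := by
    funext i
    simpa only [b.coe_toBasis, Function.comp_apply] using b.toBasis.constr_basis ℝ x i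
  have hdet : LinearMap.det L = b.toBasis.det x := by
    have h := b.toBasis.det_comp L b
    rw [hL] at h
    rw [h, ← b.coe_toBasis, b.toBasis.det_self, mul_one]
  have himage : convexHull ℝ (range x ∪ -range x) = Set.image L (lqBall n 1) := by
    rw [← convexHull_basisFun_union_neg hn, L.image_convexHull, image_union, Set.image_neg,
      ← range_comp, hL]
  rw [himage, Measure.addHaar_image_linearMap, hdet]

theorem norm_le_one_of_mem_lqBall {n : ℕ} {q : ℝ} (hq1 : 1 ≤ q) (hq2 : q ≤ 2)
    {x : EuclideanSpace ℝ (Fin n)} (hx : x ∈ lqBall n q) : ‖x‖ ≤ 1 := by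
  have hx' : ∑ i, |x i| ^ q ≤ 1 := hx
  have hcoord (i : Fin n) : |x i| ≤ 1 := by
    have h : |x i| ^ q ≤ 1 := (Finset.single_le_sum (f := fun i => |x i| ^ q)
      (fun j _ => by positivity) (Finset.mem_univ i)).trans hx'
    by_contra! hlt
    exact h.not_gt (Real.one_lt_rpow hlt (by linarith))
  rw [EuclideanSpace.norm_eq, Real.sqrt_le_one]
  refine le_trans (Finset.sum_le_sum fun i _ => ?_) hx'
  rw [Real.norm_eq_abs, ← Real.rpow_two]
  exact Real.rpow_le_rpow_of_exponent_ge_of_imp (abs_nonneg _) (hcoord i) hq2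
    fun _ h => by linarith

theorem isOpen_setOf_sum_rpow_lt_one (n : ℕ) {q : ℝ} (hq : 1 ≤ q) :
    IsOpen {x : EuclideanSpace ℝ (Fin n) | ∑ i, |x i| ^ q < 1} := by
  refine isOpen_lt (continuous_finsetSum _ fun i _ => ?_) continuous_const
  exact Continuous.rpow_const (by fun_prop) fun _ => Or.inr (by linarith)

theorem setOf_sum_rpow_lt_one_subset_lqBall (n : ℕ) (q : ℝ) :
    {x : EuclideanSpace ℝ (Fin n) | ∑ i, |x i| ^ q < 1} ⊆ lqBall n q :=
  fun x hx => (show ∑ i, |x i| ^ q < 1 from hx).le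

theorem measurableSet_lqBall (n : ℕ) {q : ℝ} (hq : 1 ≤ q) : MeasurableSet (lqBall n q) := by
  refine (isClosed_le (continuous_finsetSum _ fun i _ => ?_) continuous_const).measurableSet
  exact Continuous.rpow_const (by fun_prop) fun _ => Or.inr (by linarith)

theorem volume_lqBall_ne_top (n : ℕ) {q : ℝ} (hq1 : 1 ≤ q) (hq2 : q ≤ 2) :
    volume (lqBall n q) ≠ ⊤ := by
  have hsub : lqBall n q ⊆ Metric.closedBall 0 1 := fun x hx => by
    simpa using norm_le_one_of_mem_lqBall hq1 hq2 hx
  exact ((measure_mono hsub).trans_lt measure_closedBall_lt_top).ne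

theorem volume_lqBall_ne_zero (n : ℕ) {q : ℝ} (hq : 1 ≤ q) : volume (lqBall n q) ≠ 0 := by
  refine ne_of_gt (lt_of_lt_of_le ((isOpen_setOf_sum_rpow_lt_one n hq).measure_pos volume
    ⟨0, ?_⟩) (measure_mono (setOf_sum_rpow_lt_one_subset_lqBall n q)))
  simp [Real.zero_rpow (show q ≠ 0 by linarith)]

theorem isFiniteMeasure_unifMeasure_lqBall (n : ℕ) {q : ℝ} (hq1 : 1 ≤ q) (hq2 : q ≤ 2) :
    IsFiniteMeasure (unifMeasure n (lqBall n q)) := by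
  constructor
  simp only [unifMeasure, Measure.smul_apply, Measure.restrict_apply_univ, smul_eq_mul]
  exact ENNReal.mul_lt_top (ENNReal.inv_lt_top.mpr (volume_lqBall_ne_zero n hq1).bot_lt)
    (volume_lqBall_ne_top n hq1 hq2).lt_top

/-- Every open set of configurations containing one in the interior of the ball has positive
probability. -/
theorem jointUnif_lqBall_ne_zero {n N : ℕ} {q : ℝ} (hq1 : 1 ≤ q) (hq2 : q ≤ 2)
    {U : Set (Fin N → EuclideanSpace ℝ (Fin n))} (hU : IsOpen U)
    {x : Fin N → EuclideanSpace ℝ (Fin n)} (hxU : x ∈ U)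
    (hx : ∀ i, ∑ j, |x i j| ^ q < 1) : jointUnif n N (lqBall n q) U ≠ 0 := by
  have := isFiniteMeasure_unifMeasure_lqBall n hq1 hq2
  obtain ⟨u, hu, huU⟩ := isOpen_pi_iff'.mp hU x hxU
  refine fun h0 => ?_
  have hbox := measure_mono_null huU h0
  rw [jointUnif, Measure.pi_pi, Finset.prod_eq_zero_iff] at hbox
  obtain ⟨i, -, hi⟩ := hbox
  have hpos : 0 < volume (u i ∩ {x | ∑ j, |x j| ^ q < 1}) :=
    ((hu i).1.inter (isOpen_setOf_sum_rpow_lt_one n hq1)).measure_pos volume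
      ⟨x i, (hu i).2, hx i⟩
  have hK : volume (u i ∩ lqBall n q) ≠ 0 :=
    (hpos.trans_le (measure_mono (inter_subset_inter_right _
      (setOf_sum_rpow_lt_one_subset_lqBall n q)))).ne'
  rw [unifMeasure, Measure.smul_apply, Measure.restrict_apply (hu i).1.measurableSet,
    smul_eq_mul, mul_eq_zero, ENNReal.inv_eq_zero] at hi
  exact hi.elim (volume_lqBall_ne_top n hq1 hq2) hK

theorem ae_jointUnif_lqBall_mem {n N : ℕ} {q : ℝ} (hq1 : 1 ≤ q) (hq2 : q ≤ 2) :
    ∀ᵐ x ∂jointUnif n N (lqBall n q), ∀ i, x i ∈ lqBall n q := by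
  have := isFiniteMeasure_unifMeasure_lqBall n hq1 hq2
  have hmem : ∀ᵐ y ∂unifMeasure n (lqBall n q), y ∈ lqBall n q :=
    Measure.ae_smul_measure (ae_restrict_mem (measurableSet_lqBall n hq1)) _
  exact ae_all_iff.mpr fun i => (Measure.tendsto_eval_ae_ae (i := i)).eventually hmem

/-- For `1 ≤ q ≤ 2`, the essential supremum of the normalized volume of a random
crosspolytope in `B_qⁿ` equals `|B₁ⁿ| / |B_qⁿ|`. -/
theorem essSup_randCrossVol_lqBall
    (n : ℕ) (hn : 0 < n) (q : ℝ) (hq1 : 1 ≤ q) (hq2 : q ≤ 2) :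
    essSup (fun x => |randCrossVol n (lqBall n q) x|) (jointUnif n n (lqBall n q)) =
      (volume (lqBall n 1)).toReal / (volume (lqBall n q)).toReal := by
  set b := EuclideanSpace.basisFun (Fin n) ℝ with hb
  set C := (volume (lqBall n 1)).toReal / (volume (lqBall n q)).toReal
  have hC : 0 < C := div_pos
    (ENNReal.toReal_pos (volume_lqBall_ne_zero n le_rfl)
      (volume_lqBall_ne_top n le_rfl one_le_two))
    (ENNReal.toReal_pos (volume_lqBall_ne_zero n hq1) (volume_lqBall_ne_top n hq1 hq2))
  have hV : (fun x => |randCrossVol n (lqBall n q) x|) = fun x => |b.toBasis.det x| * C := by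
    funext x
    rw [randCrossVol, volume_convexHull_range_union_neg hn, ENNReal.toReal_mul,
      ENNReal.toReal_ofReal (abs_nonneg _), mul_div_assoc,
      abs_of_nonneg (mul_nonneg (abs_nonneg _) hC.le)]
  rw [hV, essSup_eq_sInf]
  refine IsLeast.csInf_eq ⟨?_, fun a ha => ?_⟩
  · have hle : ∀ᵐ x ∂jointUnif n n (lqBall n q), ¬ C < |b.toBasis.det x| * C := by
      filter_upwards [ae_jointUnif_lqBall_mem hq1 hq2] with x hx
      refine not_lt.mpr (mul_le_of_le_one_left hC.le ((b.abs_det_le_prod_norm x).trans ?_))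
      exact Finset.prod_le_one (fun _ _ => norm_nonneg _)
        fun i _ => norm_le_one_of_mem_lqBall hq1 hq2 (hx i)
    simpa [ae_iff] using hle
  · by_contra! haC
    have hdet : Continuous fun x : Fin n → EuclideanSpace ℝ (Fin n) => b.toBasis.det x := by
      simp only [Module.Basis.det_apply]
      refine Continuous.matrix_det (continuous_matrix fun i j => ?_)
      simp only [Module.Basis.toMatrix_apply, hb, OrthonormalBasis.coe_toBasis_repr_apply,
        EuclideanSpace.basisFun_repr]
      fun_prop
    have hU : IsOpen {x : Fin n → EuclideanSpace ℝ (Fin n) | a < |b.toBasis.det x| * C} :=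
      isOpen_lt continuous_const (hdet.abs.mul continuous_const)
    have hlim : Filter.Tendsto (fun t : ℝ => |b.toBasis.det fun i => t • b i| * C)
        (nhdsWithin 1 (Iio 1)) (nhds C) := by
      have hcont : Continuous fun t : ℝ => |b.toBasis.det fun i => t • b i| * C :=
        (hdet.comp (by fun_prop)).abs.mul continuous_const
      have hone : (b.toBasis.det fun i => (1 : ℝ) • b i) = 1 := by
        simpa using b.toBasis.det_self
      have h := hcont.tendsto 1
      simp only [hone, abs_one, one_mul] at h
      exact h.mono_left nhdsWithin_le_nhds
    obtain ⟨t, hta, ht0, ht1⟩ := ((hlim.eventually_const_lt haC).and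
      (Ioo_mem_nhdsLT (show (0 : ℝ) < 1 by norm_num))).exists
    refine jointUnif_lqBall_ne_zero hq1 hq2 hU (x := fun i => t • b i) hta (fun i => ?_) ha
    have hq0 : q ≠ 0 := by linarith
    rw [Finset.sum_eq_single i]
    · simpa [hb, abs_of_pos ht0] using Real.rpow_lt_one ht0.le ht1 (by linarith)
    · intro j _ hji
      simp [hb, hji, Real.zero_rpow hq0]
    · simp
end
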